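/- Let i ≥ −1, n ≥ 1, 0 ≤ r ≤ n+i and C ∈ C_i(n). Then: (1) for each j ∈ [r], C has a j-full-set (respectively, a j⁺-full-set) if and only if Ĉ(r) has a j-full-set (respectively, a j⁺-full-set); (2) for each j with r < j ≤ n+i, C has a j-full-set (respectively, a j⁺-full-set) if and only if Ĉ(r) has a (j+1)-full-set (respectively, a (j+1)⁺-full-set). -/

import Mathlib

/-!
Common definitions for formalizing "A recursion on maximal chains in the Tamari lattices"
(L. Nelson).

* Young diagrams are encoded by their row-length functions `lam : ℕ → ℕ` (rows indexed from 1,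
  with `lam 0 = 0`).
* Dyck paths are lists of steps (north/east).
* Tableaux are encoded by entry functions `f : ℕ × ℕ → ℕ` (1-indexed boxes; value `0` means
  "no box").  The label of box `(x, y)` is `f (x, y)`.
-/

noncomputable section

namespace TamariMaxChains

/-- A step of a lattice path: north or east. -/
inductive Step : Type
  | N : Step
  | E : Step
deriving DecidableEq

/-- Number of north steps of a path. -/
def nCount (p : List Step) : ℕ := p.count Step.N

/-- Number of east steps of a path. -/
def eCount (p : List Step) : ℕ := p.count Step.E

/-- `p` is a Dyck path: equally many norths and easts, and every prefix has at least as many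
north steps as east steps (the path never goes below the diagonal `y = x`). -/
def IsDyck (p : List Step) : Prop :=
  nCount p = eCount p ∧ ∀ q : List Step, q <+: p → eCount q ≤ nCount q

/-- `q` is a prime Dyck path: it meets the slope-one line joining its endpoints only at its
endpoints. -/
def IsPrimeDyck (q : List Step) : Prop :=
  q ≠ [] ∧ nCount q = eCount q ∧
    ∀ s : List Step, s <+: q → s ≠ [] → s ≠ q → eCount s < nCount s

/-- Covering relation of the Tamari lattice on Dyck paths:  `TamariCoverD P' P` means `P'`
covers `P`, i.e. `P'` is obtained from `P` by swapping an east step that is followed by a north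
step with the prime Dyck subpath following it. -/
def TamariCoverD (P' P : List Step) : Prop :=
  ∃ a q b : List Step, IsPrimeDyck q ∧
    P = a ++ Step.E :: (q ++ b) ∧ P' = a ++ (q ++ Step.E :: b)

/-- `lam` is the row-length function of a Young diagram: rows are indexed from `1`,
`lam x` is the number of boxes in row `x`, rows weakly decrease, finitely many boxes. -/
def IsDiagram (lam : ℕ → ℕ) : Prop :=
  lam 0 = 0 ∧ (∀ x, 1 ≤ x → lam (x + 1) ≤ lam x) ∧ ∃ N, ∀ x, N ≤ x → lam x = 0

/-- The height (number of north steps) of the prime path of row `d ≥ 1` of the Young diagram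
with row lengths `lam`:  the least `t ≥ 1` such that either `t = d` (row `0` being regarded as
an infinite row of boxes) or row `d - t` has length at least `lam d + t`. -/
def primeHeight (lam : ℕ → ℕ) (d : ℕ) : ℕ :=
  sInf {t | 1 ≤ t ∧ (t = d ∨ (t < d ∧ lam d + t ≤ lam (d - t)))}

/-- The last box of row `d` is a corner box (last box of its row and lowest box of
its column). -/
def IsCorner (lam : ℕ → ℕ) (d : ℕ) : Prop := 1 ≤ d ∧ 1 ≤ lam d ∧ lam (d + 1) < lam d

/-- The result of removing the `B`-strip of the last box `B` of row `d`: the last box of each of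
the rows `d - h + 1, …, d` is removed, where `h` is the height of the prime path of row `d`. -/
def removeStrip (lam : ℕ → ℕ) (d : ℕ) : ℕ → ℕ := fun x =>
  if d + 1 ≤ x + primeHeight lam d ∧ x ≤ d then lam x - 1 else lam x

/-- Covering relation of the Tamari lattice on Young diagrams:  `mu` covers `lam` iff `mu` is
obtained from `lam` by removing the `B`-strip of a corner box `B`. -/
def TamariCoverY (mu lam : ℕ → ℕ) : Prop := ∃ d, IsCorner lam d ∧ mu = removeStrip lam d

/-- The `B`-strip of the last box `B` of row `d`: the set of last boxes of rows
`d - h + 1, …, d`, where `h` is the height of the prime path of row `d`. -/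
def stripSet (lam : ℕ → ℕ) (d : ℕ) : Set (ℕ × ℕ) :=
  {b | b.2 = lam b.1 ∧ 1 ≤ b.2 ∧ d + 1 ≤ b.1 + primeHeight lam d ∧ b.1 ≤ d}

/-- The enclosure of the `B`-strip of the last box `B = (d, lam d)` of row `d`: all boxes
`(x, y)` with `d - h ≤ x ≤ d` and `lam d ≤ y ≤ lam d + h`, where row `0` is regarded as an
infinite row of boxes. -/
def enclosure (lam : ℕ → ℕ) (d : ℕ) : Set (ℕ × ℕ) :=
  {b | (b.1 = 0 ∨ b.2 ≤ lam b.1) ∧ 1 ≤ b.2 ∧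
    d ≤ b.1 + primeHeight lam d ∧ b.1 ≤ d ∧ lam d ≤ b.2 ∧ b.2 ≤ lam d + primeHeight lam d}

/-- The Dyck path of length `2 n` corresponding to the Young diagram `lam` contained in the
staircase `δ_{n-1}` (the Dyck path is the silhouette of the Young diagram). -/
def toDyck (n : ℕ) (lam : ℕ → ℕ) : List Step :=
  ((List.range n).flatMap fun k =>
    List.replicate (lam (n - k) - lam (n - k + 1)) Step.E ++ [Step.N]) ++
    List.replicate (n - lam 1) Step.E

/-- The prime path of row `d` of the Young diagram `lam`, as its list of steps (read from its
lower-left endpoint). -/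
def primePathList (lam : ℕ → ℕ) (d : ℕ) : List Step :=
  Step.N :: ((((List.range (primeHeight lam d - 1)).flatMap fun j =>
    List.replicate (lam (d - 1 - j) - lam (d - j)) Step.E ++ [Step.N])) ++
    List.replicate (lam d + primeHeight lam d - lam (d - (primeHeight lam d - 1))) Step.E)

/-- `S` translates to `S'` by `p` units down and `q` units to the right. -/
def TranslatesBy (p q : ℤ) (S S' : Set (ℕ × ℕ)) : Prop :=
  ∀ x y : ℕ, (x, y) ∈ S' ↔ ∃ a b : ℕ, (a, b) ∈ S ∧ (x : ℤ) = a + p ∧ (y : ℤ) = b + q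

/-- `S` translates to `S'`. -/
def Translates (S S' : Set (ℕ × ℕ)) : Prop := ∃ p q : ℤ, TranslatesBy p q S S'

/-- The length of a tableau: its number of distinct labels (for an honest tableau, labels are
exactly `1, …, tlen f`). -/
def tlen (f : ℕ × ℕ → ℕ) : ℕ := sSup {v | v ≠ 0 ∧ ∃ b, f b = v}

/-- The number of boxes in row `x` of a tableau. -/
def rowLen (f : ℕ × ℕ → ℕ) (x : ℕ) : ℕ := sSup {y | f (x, y) ≠ 0}

/-- The number of boxes in column `y` of a tableau. -/
def colLen (f : ℕ × ℕ → ℕ) (y : ℕ) : ℕ := sSup {x | f (x, y) ≠ 0}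

/-- `f` is (the entry function of) a tableau: the support is a Young diagram (1-indexed),
rows strictly increase, columns weakly increase, and the set of labels is exactly
`{1, …, tlen f}`. -/
def IsTableau (f : ℕ × ℕ → ℕ) : Prop :=
  (∀ y, f (0, y) = 0) ∧ (∀ x, f (x, 0) = 0) ∧
  {b : ℕ × ℕ | f b ≠ 0}.Finite ∧
  (∀ x y x' y', 1 ≤ x' → x' ≤ x → 1 ≤ y' → y' ≤ y → f (x, y) ≠ 0 → f (x', y') ≠ 0) ∧
  (∀ x y, f (x, y) ≠ 0 → f (x, y + 1) ≠ 0 → f (x, y) < f (x, y + 1)) ∧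
  (∀ x y, f (x, y) ≠ 0 → f (x + 1, y) ≠ 0 → f (x, y) ≤ f (x + 1, y)) ∧
  (∀ v, 1 ≤ v → (v ≤ tlen f ↔ ∃ b, f b = v))

/-- `T^(r)`: the subtableau of all entries at most `r`. -/
def trunc (f : ℕ × ℕ → ℕ) (r : ℕ) : ℕ × ℕ → ℕ := fun b => if f b ≤ r then f b else 0

/-- The shape (row-length function) of a tableau. -/
def shapeOf (f : ℕ × ℕ → ℕ) : ℕ → ℕ := fun x => rowLen f x

/-- The row index of the end-box of the `k`-set of `f` (the maximal row index of a box
labeled `k`). -/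
def endRow (f : ℕ × ℕ → ℕ) (k : ℕ) : ℕ := sSup {x | ∃ y, f (x, y) = k}

/-- `Y 0 ⋗ Y 1 ⋗ ⋯ ⋗ Y l` is a saturated chain in the Tamari order on Young diagrams whose
maximal element `Y 0` is the empty diagram (each `Y r` covers `Y (r+1)`). -/
def IsTamariChain (Y : ℕ → ℕ → ℕ) (l : ℕ) : Prop :=
  (∀ r, r ≤ l → IsDiagram (Y r)) ∧ (∀ x, Y 0 x = 0) ∧
    ∀ r, r < l → TamariCoverY (Y r) (Y (r + 1))

/-- The tableau `ψ(C)` of the saturated chain `C = (∅ = Y 0 ⋗ ⋯ ⋗ Y l)`: the boxes removed in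
the transition `Y (r-1) ⋗ Y r` are labeled `r`; that is, each box of `Y l` is labeled by the
least `r` such that the box belongs to `Y r`. -/
def psiFun (Y : ℕ → ℕ → ℕ) (l : ℕ) : ℕ × ℕ → ℕ := fun b =>
  if 1 ≤ b.1 ∧ 1 ≤ b.2 ∧ b.2 ≤ Y l b.1 then sInf {r | r ≤ l ∧ b.2 ≤ Y r b.1} else 0

/-- `f` is a `ψ`-tableau: it is in the image of `ψ`. -/
def IsPsiTab (f : ℕ × ℕ → ℕ) : Prop :=
  ∃ l Y, IsTamariChain Y l ∧ f = psiFun Y l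

/-- Row lengths of the staircase shape `δ_{n-1} = (n-1, n-2, …, 1)`: row `x ≥ 1` has `n - x`
boxes. -/
def dstair (n : ℕ) : ℕ → ℕ := fun x => if x = 0 then 0 else n - x

/-- `C_i(n)`, via `ψ`: the set of maximal chains of length `n + i` in the Tamari lattice `T_n`,
identified with the `ψ`-tableaux of length `n + i` and shape `δ_{n-1}`. -/
def MemC (i : ℤ) (n : ℕ) (f : ℕ × ℕ → ℕ) : Prop :=
  IsTableau f ∧ IsPsiTab f ∧ (∀ x, rowLen f x = dstair n x) ∧ (tlen f : ℤ) = (n : ℤ) + i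

/-- The `r`-set of `f` (of shape `δ_{n-1}`) is a full-set with end-box `(k, n - k)`:
it begins in row `1` and ends in the outer diagonal, at the box `(k, n - k)`. -/
def HasFullSetAt (f : ℕ × ℕ → ℕ) (n r k : ℕ) : Prop :=
  (∃ y, f (1, y) = r) ∧ 1 ≤ k ∧ k ≤ n - 1 ∧ f (k, n - k) = r ∧
    ∀ x y, f (x, y) = r → x ≤ k

/-- `f` has an `r`-full-set. -/
def HasFullSet (f : ℕ × ℕ → ℕ) (n r : ℕ) : Prop := ∃ k, HasFullSetAt f n r k

/-- `f` has an `r⁺`-full-set (plus-full-set): an `r`-full-set whose end-box `(k, n-k)` satisfies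
`k = n - 1`, or `k ≤ n - 2` and the southwest neighbor has a smaller label. -/
def HasPlusFullSet (f : ℕ × ℕ → ℕ) (n r : ℕ) : Prop :=
  ∃ k, HasFullSetAt f n r k ∧ (k = n - 1 ∨ (k ≤ n - 2 ∧ f (k + 1, n - k - 1) < r))

/-- `F_i^r(n)`: the set of `C ∈ C_i(n)` whose `r`-set is a plus-full-set and whose `j`-set is
not a plus-full-set for any `j ∈ [r-1]`. -/
def MemF (i : ℤ) (n : ℕ) (r : ℕ) (f : ℕ × ℕ → ℕ) : Prop :=
  MemC i n f ∧ HasPlusFullSet f n r ∧ ∀ j, 1 ≤ j → j < r → ¬ HasPlusFullSet f n j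

/-- `N_i(n)`: the set of `C ∈ C_i(n)` having no plus-full-sets. -/
def MemN (i : ℤ) (n : ℕ) (f : ℕ × ℕ → ℕ) : Prop :=
  MemC i n f ∧ ∀ r, ¬ HasPlusFullSet f n r

/-- `α_d`: shift all rows of index greater than `d` down one row and repeat row `d` in
row `d + 1`. -/
def alphaFun (d : ℕ) (f : ℕ × ℕ → ℕ) : ℕ × ℕ → ℕ := fun b =>
  if b.1 ≤ d then f b else f (b.1 - 1, b.2)

/-- `β_d`: append a box labeled `tlen f + 1` at the end of each of the rows `1, …, d`. -/
def betaFun (d : ℕ) (f : ℕ × ℕ → ℕ) : ℕ × ℕ → ℕ := fun b =>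
  if 1 ≤ b.1 ∧ b.1 ≤ d ∧ b.2 = rowLen f b.1 + 1 then tlen f + 1 else f b

/-- The number of boxes of row `x` of `f` whose label is at most `r` (these occupy an initial
segment of the row). -/
def lowLen (f : ℕ × ℕ → ℕ) (r x : ℕ) : ℕ := sSup {y | f (x, y) ≠ 0 ∧ f (x, y) ≤ r}

/-- The row index `d` used in the definition of `Ĉ(r)`: the minimal `k ∈ [n-1]` with
`C (k, n-k) ≤ r` if such `k` exists, and `n` otherwise. -/
def hatD (f : ℕ × ℕ → ℕ) (n r : ℕ) : ℕ :=
  sInf ({k | 1 ≤ k ∧ k ≤ n - 1 ∧ 1 ≤ f (k, n - k) ∧ f (k, n - k) ≤ r} ∪ {n})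

/-- `Ĉ(r)` for `C ∈ C_i(n)` and `0 ≤ r ≤ n + i`: starting from `β_d(α_d(C^(r)))` (where `d` is
as in `hatD`), the entries of `C` greater than `r` of row index less than `d` are translated one
unit to the right, those of row index greater than `d` are translated one unit down, and all
these labels are incremented by one. -/
def hatFun (f : ℕ × ℕ → ℕ) (n r : ℕ) : ℕ × ℕ → ℕ := fun b =>
  let d := hatD f n r
  let x := b.1
  let y := b.2
  if x = 0 ∨ y = 0 then 0
  else if x ≤ d then
    if f (x, y) ≠ 0 ∧ f (x, y) ≤ r then f (x, y)
    else if y = lowLen f r x + 1 then r + 1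
    else if r < f (x, y - 1) then f (x, y - 1) + 1
    else 0
  else if x = d + 1 then f (d, y)
  else if f (x - 1, y) = 0 then 0
  else if f (x - 1, y) ≤ r then f (x - 1, y)
  else f (x - 1, y) + 1

/-- `RepBy i m t r C0 C` : `C = (φ_{i,m+t-1}^{r 1} ∘ φ_{i,m+t-2}^{r 2} ∘ ⋯ ∘ φ_{i,m}^{r t}) C0`,
each factor being applied within its domain. -/
def RepBy (i : ℤ) (m t : ℕ) (r : ℕ → ℕ) (C0 C : ℕ × ℕ → ℕ) : Prop :=
  ∃ D : ℕ → ℕ × ℕ → ℕ, D 0 = C0 ∧ D t = C ∧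
    ∀ s, s < t →
      MemC i (m + s) (D s) ∧
      ((r (t - s) : ℤ) ≤ (m : ℤ) + s + i) ∧
      (∀ j, 1 ≤ j → j ≤ r (t - s) → ¬ HasPlusFullSet (D s) (m + s) j) ∧
      D (s + 1) = hatFun (D s) (m + s) (r (t - s))

/-- The set `𝕏_{d,n-1}^r` of Theorem 4.3: `ψ`-tableaux of length `r`, contained in `δ_{n-1}`,
whose row `d` has length `n - d` and whose prime path of row `d` has height `d`. -/
def MemX (d n r : ℕ) (f : ℕ × ℕ → ℕ) : Prop :=
  IsTableau f ∧ IsPsiTab f ∧ tlen f = r ∧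
    (∀ x, 1 ≤ x → rowLen f x ≤ n - x) ∧
    rowLen f d = n - d ∧
    primeHeight (shapeOf f) d = d

/-- The set `ℤ_{d,n}^{r+1}` of Theorem 4.3: `ψ`-tableaux of length `r + 1`, contained in `δ_n`,
such that rows `d` and `d+1` of the truncation at `r` are identical, the end-box of the
`(r+1)`-set is `(d, n-d+1)`, and the prime path of `(d, n-d+1)` has height `d`. -/
def MemZ (d n r : ℕ) (g : ℕ × ℕ → ℕ) : Prop :=
  IsTableau g ∧ IsPsiTab g ∧ tlen g = r + 1 ∧
    (∀ x, 1 ≤ x → rowLen g x ≤ n + 1 - x) ∧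
    (∀ y, trunc g r (d, y) = trunc g r (d + 1, y)) ∧
    g (d, n - d + 1) = r + 1 ∧ (∀ x y, g (x, y) = r + 1 → x ≤ d) ∧
    primeHeight (shapeOf g) d = d

/-- The extra condition making a full-set a plus-full-set. -/
def PlusCond (f : ℕ × ℕ → ℕ) (n r k : ℕ) : Prop :=
  k = n - 1 ∨ (k ≤ n - 2 ∧ f (k + 1, n - k - 1) < r)

theorem transfer {C H : ℕ × ℕ → ℕ} {n m j j' : ℕ}
    (h1 : ∀ k, HasFullSetAt C n j k →
      ∃ k', HasFullSetAt H m j' k' ∧ (PlusCond C n j k → PlusCond H m j' k'))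
    (h2 : ∀ k', HasFullSetAt H m j' k' →
      ∃ k, HasFullSetAt C n j k ∧ (PlusCond H m j' k' → PlusCond C n j k)) :
    (HasFullSet C n j ↔ HasFullSet H m j') ∧ (HasPlusFullSet C n j ↔ HasPlusFullSet H m j') := by
  refine ⟨⟨?_, ?_⟩, ⟨?_, ?_⟩⟩
  · rintro ⟨k, hk⟩
    obtain ⟨k', h, -⟩ := h1 k hk
    exact ⟨k', h⟩
  · rintro ⟨k, hk⟩
    obtain ⟨k', h, -⟩ := h2 k hk
    exact ⟨k', h⟩
  · rintro ⟨k, hk, hp⟩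
    obtain ⟨k', h, h'⟩ := h1 k hk
    exact ⟨k', h, h' hp⟩
  · rintro ⟨k, hk, hp⟩
    obtain ⟨k', h, h'⟩ := h2 k hk
    exact ⟨k', h, h' hp⟩

/-- The properties of `C`, `H = Ĉ(r)` and `d` that the proof uses. -/
structure HatData (C H : ℕ × ℕ → ℕ) (n r d : ℕ) : Prop where
  d1 : 1 ≤ d
  dn : d ≤ n
  supp : ∀ x y, C (x, y) ≠ 0 → 1 ≤ x ∧ 1 ≤ y ∧ x + y ≤ n
  rowd : ∀ y, C (d, y) ≤ r
  diag : ∀ k, 1 ≤ k → k < d → r < C (k, n - k)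
  low : ∀ x y v, x ≤ d → 1 ≤ v → v ≤ r → (H (x, y) = v ↔ C (x, y) = v)
  up : ∀ x y, x ≤ d → r < C (x, y) → H (x, y + 1) = C (x, y) + 1
  up' : ∀ x y, x ≤ d → r + 1 < H (x, y) → ∃ y', y = y' + 1 ∧ H (x, y) = C (x, y') + 1
  down : ∀ x y, d ≤ x → C (x, y) ≤ r → H (x + 1, y) = C (x, y)
  down' : ∀ x y, d ≤ x → r < C (x, y) → H (x + 1, y) = C (x, y) + 1

namespace HatData

variable {C H : ℕ × ℕ → ℕ} {n r d : ℕ}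

theorem low_case (h : HatData C H n r d) (j : ℕ) (hj : 1 ≤ j) (hjr : j ≤ r) :
    (HasFullSet C n j ↔ HasFullSet H (n + 1) j) ∧
      (HasPlusFullSet C n j ↔ HasPlusFullSet H (n + 1) j) := by
  have plus : ∀ k, 1 ≤ k → d ≤ k → k ≤ n - 1 → (PlusCond C n j k ↔ PlusCond H (n + 1) j (k + 1)) := by
    intro k hk hdk hkn
    unfold PlusCond
    have e : n + 1 - (k + 1) - 1 = n - k - 1 := by omega
    rw [e]
    have key : C (k + 1, n - k - 1) < j ↔ H (k + 1 + 1, n - k - 1) < j := by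
      by_cases hc : C (k + 1, n - k - 1) ≤ r
      · rw [h.down _ _ (by omega) hc]
      · rw [h.down' _ _ (by omega) (by omega)]
        omega
    rw [key]
    have : k = n - 1 ↔ k + 1 = n + 1 - 1 := by omega
    have : k ≤ n - 2 ∧ k ≠ n - 1 ↔ k + 1 ≤ n + 1 - 2 ∧ k + 1 ≠ n + 1 - 1 := by omega
    tauto
  apply transfer
  · rintro k ⟨⟨y, hy⟩, hk1, hkn, hk, hall⟩
    have hdk : d ≤ k := by
      by_contra hlt
      have := h.diag k hk1 (by omega)
      omega
    refine ⟨k + 1, ⟨⟨y, (h.low 1 y j h.d1 hj hjr).2 hy⟩, by omega, by omega, ?_, ?_⟩,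
      (plus k hk1 hdk hkn).1⟩
    · rw [show n + 1 - (k + 1) = n - k by omega, h.down _ _ hdk (by omega), hk]
    · intro x y hxy
      by_cases hx : x ≤ d
      · omega
      · obtain ⟨x, rfl⟩ : ∃ z, x = z + 1 := ⟨x - 1, by omega⟩
        by_cases hc : C (x, y) ≤ r
        · rw [h.down _ _ (by omega) hc] at hxy
          have := hall _ _ hxy
          omega
        · rw [h.down' _ _ (by omega) (by omega)] at hxy
          omega
  · rintro k ⟨⟨y, hy⟩, hk1, hkn, hk, hall⟩
    have hdk : d < k := by
      by_contra hlt
      have h3 := (h.low k _ j (by omega) hj hjr).1 hk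
      have := h.supp k (n + 1 - k) (by omega)
      omega
    obtain ⟨k, rfl⟩ : ∃ z, k = z + 1 := ⟨k - 1, by omega⟩
    have hd1 := h.d1
    refine ⟨k, ⟨⟨y, (h.low 1 y j h.d1 hj hjr).1 hy⟩, by omega, by omega, ?_, ?_⟩,
      (plus k (by omega) (by omega) (by omega)).2⟩
    · rw [show n + 1 - (k + 1) = n - k by omega] at hk
      by_cases hc : C (k, n - k) ≤ r
      · rwa [h.down _ _ (by omega) hc] at hk
      · rw [h.down' _ _ (by omega) (by omega)] at hk
        omega
    · intro x y hxy
      by_cases hx : x < d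
      · omega
      · have := hall (x + 1) y (by rw [h.down _ _ (by omega) (by omega), hxy])
        omega

theorem high_case (h : HatData C H n r d) (j : ℕ) (hjr : r < j) :
    (HasFullSet C n j ↔ HasFullSet H (n + 1) (j + 1)) ∧
      (HasPlusFullSet C n j ↔ HasPlusFullSet H (n + 1) (j + 1)) := by
  have hd1 := h.d1
  have hdn := h.dn
  have plus1 : ∀ k, 1 ≤ k → d ≤ k → k ≤ n - 1 →
      (PlusCond C n j k ↔ PlusCond H (n + 1) (j + 1) (k + 1)) := by
    intro k hk hdk hkn
    unfold PlusCond
    have e : n + 1 - (k + 1) - 1 = n - k - 1 := by omega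
    rw [e]
    have key : C (k + 1, n - k - 1) < j ↔ H (k + 1 + 1, n - k - 1) < j + 1 := by
      by_cases hc : C (k + 1, n - k - 1) ≤ r
      · rw [h.down _ _ (by omega) hc]
        omega
      · rw [h.down' _ _ (by omega) (by omega)]
        omega
    rw [key]
    have : k = n - 1 ↔ k + 1 = n + 1 - 1 := by omega
    have : k ≤ n - 2 ∧ k ≠ n - 1 ↔ k + 1 ≤ n + 1 - 2 ∧ k + 1 ≠ n + 1 - 1 := by omega
    tauto
  have plus2 : ∀ k, 1 ≤ k → k < d →
      (PlusCond C n j k ↔ PlusCond H (n + 1) (j + 1) k) := by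
    intro k hk hkd
    unfold PlusCond
    by_cases hkd' : k + 1 = d
    · have hH : H (k + 1, n + 1 - k - 1) < j + 1 := by
        by_contra hge
        obtain ⟨y', hy, hy'⟩ := h.up' (k + 1) (n + 1 - k - 1) (by omega) (by omega)
        have := h.rowd y'
        rw [← hkd'] at this
        omega
      have hCc : C (k + 1, n - k - 1) < j := by
        have := h.rowd (n - k - 1)
        rw [← hkd'] at this
        omega
      have : k = n - 1 ∨ k ≤ n - 2 := by omega
      have : k ≤ n + 1 - 2 := by omega
      tauto
    · have e : n + 1 - k - 1 = n - k - 1 + 1 := by omega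
      have hg := h.diag (k + 1) (by omega) (by omega)
      rw [show n - (k + 1) = n - k - 1 by omega] at hg
      rw [e, h.up _ _ (by omega) hg]
      omega
  apply transfer
  · rintro k ⟨⟨y, hy⟩, hk1, hkn, hk, hall⟩
    have hrow : ∃ y, H (1, y) = j + 1 := ⟨y + 1, by rw [h.up _ _ hd1 (by omega), hy]⟩
    by_cases hkd : k < d
    · refine ⟨k, ⟨hrow, hk1, by omega, ?_, ?_⟩, (plus2 k hk1 hkd).1⟩
      · rw [show n + 1 - k = n - k + 1 by omega, h.up _ _ (by omega) (by omega), hk]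
      · intro x y hxy
        by_cases hx : x ≤ d
        · obtain ⟨y', -, h2⟩ := h.up' x y hx (by omega)
          exact hall x y' (by omega)
        · obtain ⟨x, rfl⟩ : ∃ z, x = z + 1 := ⟨x - 1, by omega⟩
          by_cases hc : C (x, y) ≤ r
          · rw [h.down _ _ (by omega) hc] at hxy
            omega
          · rw [h.down' _ _ (by omega) (by omega)] at hxy
            have := hall x y (by omega)
            omega
    · refine ⟨k + 1, ⟨hrow, by omega, by omega, ?_, ?_⟩, (plus1 k hk1 (by omega) hkn).1⟩
      · rw [show n + 1 - (k + 1) = n - k by omega, h.down' _ _ (by omega) (by omega), hk]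
      · intro x y hxy
        by_cases hx : x ≤ d
        · omega
        · obtain ⟨x, rfl⟩ : ∃ z, x = z + 1 := ⟨x - 1, by omega⟩
          by_cases hc : C (x, y) ≤ r
          · rw [h.down _ _ (by omega) hc] at hxy
            omega
          · rw [h.down' _ _ (by omega) (by omega)] at hxy
            have := hall x y (by omega)
            omega
  · rintro k ⟨⟨y, hy⟩, hk1, hkn, hk, hall⟩
    have hrow : ∃ y, C (1, y) = j := by
      obtain ⟨y', -, h2⟩ := h.up' 1 y hd1 (by omega)
      exact ⟨y', by omega⟩
    by_cases hkd : k ≤ d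
    · obtain ⟨y', h1, h2⟩ := h.up' k _ hkd (by rw [hk]; omega)
      have hy' : y' = n - k := by omega
      subst hy'
      have hlt : k < d := by
        rcases hkd.lt_or_eq with hlt | rfl
        · exact hlt
        · have := h.rowd (n - k)
          omega
      refine ⟨k, ⟨hrow, hk1, by omega, by omega, ?_⟩, (plus2 k hk1 hlt).2⟩
      intro x y hxy
      by_cases hx : x ≤ d
      · exact hall x (y + 1) (by rw [h.up _ _ hx (by omega), hxy])
      · have := hall (x + 1) y (by rw [h.down' _ _ (by omega) (by omega), hxy])
        omega
    · obtain ⟨k, rfl⟩ : ∃ z, k = z + 1 := ⟨k - 1, by omega⟩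
      refine ⟨k, ⟨hrow, by omega, by omega, ?_, ?_⟩, (plus1 k (by omega) (by omega) (by omega)).2⟩
      · rw [show n + 1 - (k + 1) = n - k by omega] at hk
        by_cases hc : C (k, n - k) ≤ r
        · rw [h.down _ _ (by omega) hc] at hk
          omega
        · rw [h.down' _ _ (by omega) (by omega)] at hk
          omega
      · intro x y hxy
        by_cases hx : x ≤ d
        · omega
        · have := hall (x + 1) y (by rw [h.down' _ _ (by omega) (by omega), hxy])
          omega

end HatData

theorem memC_supp {i : ℤ} {n : ℕ} {C : ℕ × ℕ → ℕ} (hC : MemC i n C) (x y : ℕ) :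
    C (x, y) ≠ 0 ↔ 1 ≤ x ∧ 1 ≤ y ∧ x + y ≤ n := by
  obtain ⟨⟨h0, h0', hfin, hdown, -, -, -⟩, -, hrow, -⟩ := hC
  have hb : ∀ x, BddAbove {y | C (x, y) ≠ 0} := by
    intro x
    have : {y | C (x, y) ≠ 0}.Finite :=
      hfin.preimage (f := fun y => (x, y)) (fun a _ b _ hab => by simpa using hab)
    exact this.bddAbove
  constructor
  · intro h
    have hx : x ≠ 0 := by
      rintro rfl
      exact h (h0 y)
    have hy : y ≠ 0 := by
      rintro rfl
      exact h (h0' x)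
    have h1 : y ≤ rowLen C x := le_csSup (hb x) h
    rw [hrow x, dstair, if_neg hx] at h1
    omega
  · rintro ⟨hx, hy, hxy⟩
    have h1 : rowLen C x = n - x := by
      rw [hrow x, dstair, if_neg (by omega)]
    have hne : {y | C (x, y) ≠ 0}.Nonempty := by
      by_contra hemp
      rw [Set.not_nonempty_iff_eq_empty] at hemp
      rw [rowLen, hemp] at h1
      simp at h1
      omega
    have h2 : C (x, rowLen C x) ≠ 0 := Nat.sSup_mem hne (hb x)
    rw [h1] at h2
    exact hdown x (n - x) x y hx le_rfl hy (by omega) h2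

theorem memC_mono {i : ℤ} {n : ℕ} {C : ℕ × ℕ → ℕ} (hC : MemC i n C) (x y t : ℕ)
    (hy : 1 ≤ y) (h : C (x, y + t) ≠ 0) : C (x, y) ≤ C (x, y + t) := by
  have hs := memC_supp hC
  induction t with
  | zero => exact le_rfl
  | succ t ih =>
    have h1 := (hs _ _).1 h
    have h2 : C (x, y + t) ≠ 0 := (hs _ _).2 (by omega)
    have h3 := hC.1.2.2.2.2.1 x (y + t) h2 h
    have := ih h2
    rw [← add_assoc]
    omega

theorem lowLen_ne {i : ℤ} {n : ℕ} {C : ℕ × ℕ → ℕ} (hC : MemC i n C) (r x y : ℕ)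
    (h : r < C (x, y)) : y ≠ lowLen C r x := by
  have hs := memC_supp hC
  intro he
  have hy := (hs x y).1 (by omega)
  have hne : {y | C (x, y) ≠ 0 ∧ C (x, y) ≤ r}.Nonempty := by
    by_contra hemp
    rw [Set.not_nonempty_iff_eq_empty] at hemp
    rw [lowLen, hemp] at he
    simp at he
    omega
  have hb : BddAbove {y | C (x, y) ≠ 0 ∧ C (x, y) ≤ r} :=
    ⟨n, fun z hz => by have := (hs x z).1 hz.1; omega⟩
  have h2 : C (x, lowLen C r x) ≠ 0 ∧ C (x, lowLen C r x) ≤ r := Nat.sSup_mem hne hb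
  rw [← he] at h2
  omega

theorem hatData {i : ℤ} {n : ℕ} (hn : 1 ≤ n) {C : ℕ × ℕ → ℕ} (hC : MemC i n C) (r : ℕ) :
    HatData C (hatFun C n r) n r (hatD C n r) := by
  have hs := memC_supp hC
  have hmem : hatD C n r ∈
      ({k | 1 ≤ k ∧ k ≤ n - 1 ∧ 1 ≤ C (k, n - k) ∧ C (k, n - k) ≤ r} ∪ {n} : Set ℕ) :=
    Nat.sInf_mem ⟨n, Or.inr rfl⟩
  have hmin : ∀ k, 1 ≤ k → k < hatD C n r → r < C (k, n - k) := by
    intro k hk1 hk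
    have hdn : hatD C n r ≤ n := Nat.sInf_le (Or.inr rfl)
    have h1 : C (k, n - k) ≠ 0 := (hs _ _).2 (by omega)
    by_contra hle
    have : hatD C n r ≤ k := Nat.sInf_le (Or.inl ⟨hk1, by omega, by omega, by omega⟩)
    omega
  have hmono : ∀ x y, C (x, y + 1) ≠ 0 → C (x, y) ≤ C (x, y + 1) := by
    intro x y h
    rcases Nat.eq_zero_or_pos y with rfl | hy
    · have : C (x, 0) = 0 := hC.1.2.1 x
      omega
    · exact memC_mono hC x y 1 hy h
  have hne := lowLen_ne hC r
  have hCx0 : ∀ x, C (x, 0) = 0 := hC.1.2.1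
  have hC0y : ∀ y, C (0, y) = 0 := hC.1.1
  have hrowd : ∀ y, C (hatD C n r, y) ≤ r := by
    intro y
    by_cases hz : C (hatD C n r, y) = 0
    · omega
    have h1 := (hs _ _).1 hz
    rcases hmem with ⟨h2, h3, h4, h5⟩ | h2
    · have h6 := memC_mono hC (hatD C n r) y (n - hatD C n r - y) h1.2.1
      rw [show y + (n - hatD C n r - y) = n - hatD C n r by omega] at h6
      have := h6 (by omega)
      omega
    · have h2 : hatD C n r = n := h2
      omega
  have hd1 : 1 ≤ hatD C n r := by
    rcases hmem with h | h
    · exact h.1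
    · have h : hatD C n r = n := h
      omega
  refine ⟨hd1, Nat.sInf_le (Or.inr rfl), fun x y => (hs x y).1, hrowd, hmin, ?_, ?_, ?_, ?_, ?_⟩
  · intro x y v hx hv hvr
    by_cases hxy : x = 0 ∨ y = 0
    · have : C (x, y) = 0 := by
        rcases hxy with rfl | rfl
        · exact hC0y y
        · exact hCx0 x
      simp only [hatFun, if_pos hxy]
      omega
    · simp only [hatFun, if_neg hxy, if_pos hx]
      split_ifs <;> omega
  · intro x y hx h
    have h1 := (hs x y).1 (by omega)
    have h2 := hne x y h
    have h3 := hmono x y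
    simp only [hatFun]
    rw [if_neg (by omega), if_pos hx, if_neg (by omega), if_neg (by omega), Nat.add_sub_cancel,
      if_pos h]
  · intro x y hx h
    simp only [hatFun] at h ⊢
    split_ifs at h ⊢
    all_goals first
      | omega
      | exact ⟨y - 1, by omega, rfl⟩
  · intro x y hx h
    by_cases hy : y = 0
    · subst hy
      simp [hatFun, hCx0]
    · simp only [hatFun, Nat.add_sub_cancel]
      rw [if_neg (by omega), if_neg (by omega)]
      split_ifs with h1 h2
      · rw [show hatD C n r = x by omega]
      · omega
      · rfl
  · intro x y hx h
    have hy := (hs x y).1 (by omega)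
    have hxd : x ≠ hatD C n r := by
      intro e
      have := hrowd y
      rw [← e] at this
      omega
    simp only [hatFun, Nat.add_sub_cancel]
    rw [if_neg (by omega), if_neg (by omega), if_neg (by omega), if_neg (by omega),
      if_neg (by omega)]

/-- **Proposition 4.7.**  Let `i ≥ -1`, `n ≥ 1`, `0 ≤ r ≤ n + i` and `C ∈ C_i(n)`.  Then:
(1) for `j ∈ [r]`, `C` has a `j`-full-set (resp. `j⁺`-full-set) iff `Ĉ(r)` has a `j`-full-set
(resp. `j⁺`-full-set);  (2) for `r < j ≤ n + i`, `C` has a `j`-full-set (resp. `j⁺`-full-set)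
iff `Ĉ(r)` has a `(j+1)`-full-set (resp. `(j+1)⁺`-full-set). -/
theorem hat_preserves_full_sets (i : ℤ) (hi : -1 ≤ i) (n : ℕ) (hn : 1 ≤ n) (r : ℕ)
    (hr : (r : ℤ) ≤ (n : ℤ) + i) (C : ℕ × ℕ → ℕ) (hC : MemC i n C) :
    (∀ j, 1 ≤ j → j ≤ r →
      ((HasFullSet C n j ↔ HasFullSet (hatFun C n r) (n + 1) j) ∧
       (HasPlusFullSet C n j ↔ HasPlusFullSet (hatFun C n r) (n + 1) j))) ∧
    (∀ j : ℕ, r < j → (j : ℤ) ≤ (n : ℤ) + i →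
      ((HasFullSet C n j ↔ HasFullSet (hatFun C n r) (n + 1) (j + 1)) ∧
       (HasPlusFullSet C n j ↔ HasPlusFullSet (hatFun C n r) (n + 1) (j + 1)))) := by
  have h := hatData hn hC r
  exact ⟨fun j hj hjr => h.low_case j hj hjr, fun j hjr _ => h.high_case j hjr⟩

end TamariMaxChains
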